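/- The group generated by row permutations, column permutations, and quadrant permutations of a 4×4 array, viewed as permutations of GF(2)^4 via binary coordinates, is contained in AGL(4,2). -/

import Mathlib

/-- Split an element of `Fin 4` into its high and low binary bits. -/
def bits : Fin 4 ≃ Fin 2 × Fin 2 :=
  ⟨fun i => (⟨i.val / 2, by omega⟩, ⟨i.val % 2, by omega⟩),
   fun p => ⟨2 * p.1.val + p.2.val, by omega⟩,
   by decide, by decide⟩

/-- Regroup `((i₁,i₀),(j₁,j₀))` as `((i₁,j₁),(i₀,j₀))` : (block, position within block). -/
def regroup : (Fin 2 × Fin 2) × (Fin 2 × Fin 2) ≃ (Fin 2 × Fin 2) × (Fin 2 × Fin 2) :=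
  ⟨fun p => ((p.1.1, p.2.1), (p.1.2, p.2.2)),
   fun p => ((p.1.1, p.2.1), (p.1.2, p.2.2)),
   by decide, by decide⟩

/-- Identify a cell `(i,j)` with (its 2×2 quadrant, its position within that quadrant). -/
def toBlocks : Fin 4 × Fin 4 ≃ (Fin 2 × Fin 2) × (Fin 2 × Fin 2) :=
  (bits.prodCongr bits).trans regroup

/-- Row permutation of the 4×4 array. -/
def rowPerm (σ : Equiv.Perm (Fin 4)) : Equiv.Perm (Fin 4 × Fin 4) :=
  σ.prodCongr (Equiv.refl (Fin 4))

/-- Column permutation of the 4×4 array. -/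
def colPerm (τ : Equiv.Perm (Fin 4)) : Equiv.Perm (Fin 4 × Fin 4) :=
  (Equiv.refl (Fin 4)).prodCongr τ

/-- Quadrant permutation: permute the four 2×2 quadrants rigidly according to `ρ`. -/
def quadPerm (ρ : Equiv.Perm (Fin 2 × Fin 2)) : Equiv.Perm (Fin 4 × Fin 4) :=
  toBlocks.permCongr.symm (ρ.prodCongr (Equiv.refl (Fin 2 × Fin 2)))

/-- Identify the cell `(i,j)` with the vector `(i₁,i₀,j₁,j₀) ∈ GF(2)⁴` via binary expansion. -/
def encode (c : Fin 4 × Fin 4) : Fin 4 → ZMod 2 :=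
  ![(c.1.val / 2 : ℕ), (c.1.val % 2 : ℕ), (c.2.val / 2 : ℕ), (c.2.val % 2 : ℕ)]

/-- A permutation of the 4×4 array is affine when, transported to GF(2)⁴ via binary
coordinates, it has the form `v ↦ A v + b` with `A` invertible linear. -/
def IsAffinePerm (g : Equiv.Perm (Fin 4 × Fin 4)) : Prop :=
  ∃ (A : (Fin 4 → ZMod 2) ≃ₗ[ZMod 2] (Fin 4 → ZMod 2)) (b : Fin 4 → ZMod 2),
    ∀ c : Fin 4 × Fin 4, encode (g c) = A (encode c) + b

/-- The cells corresponding to the standard basis vectors of `GF(2)⁴`. -/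
def basisCell : Fin 4 → Fin 4 × Fin 4 := ![(2, 0), (1, 0), (0, 2), (0, 1)]

/-- The matrix of the candidate linear part of `g`. -/
def linPart (g : Equiv.Perm (Fin 4 × Fin 4)) : Matrix (Fin 4) (Fin 4) (ZMod 2) :=
  fun i k => encode (g (basisCell k)) i - encode (g (0, 0)) i

theorem encode_injective : Function.Injective encode := by
  have key : ∀ i j : Fin 4, ((i.val / 2 : ℕ) : ZMod 2) = ((j.val / 2 : ℕ) : ZMod 2) →
      ((i.val % 2 : ℕ) : ZMod 2) = ((j.val % 2 : ℕ) : ZMod 2) → i = j := by decide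
  intro c d h
  exact Prod.ext (key _ _ (congrFun h 0) (congrFun h 1)) (key _ _ (congrFun h 2) (congrFun h 3))

theorem encode_surjective : Function.Surjective encode := by
  have h : Function.Bijective encode := by
    rw [Fintype.bijective_iff_injective_and_card]
    exact ⟨encode_injective, by simp [ZMod.card]⟩
  exact h.2

theorem isAffinePerm_of_eq (g : Equiv.Perm (Fin 4 × Fin 4))
    (h : ∀ c i, encode (g c) i =
      (linPart g i 0 * encode c 0 + linPart g i 1 * encode c 1 + linPart g i 2 * encode c 2
        + linPart g i 3 * encode c 3) + encode (g (0, 0)) i) : IsAffinePerm g := by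
  have key : ∀ c, encode (g c) = (linPart g).mulVecLin (encode c) + encode (g (0, 0)) := by
    intro c
    ext i
    rw [h c i]
    simp [Matrix.mulVec, dotProduct, Fin.sum_univ_four]
  have inj : Function.Injective (linPart g).mulVecLin := by
    intro x y hxy
    obtain ⟨c, rfl⟩ := encode_surjective x
    obtain ⟨d, rfl⟩ := encode_surjective y
    have : encode (g c) = encode (g d) := by rw [key c, key d, hxy]
    rw [g.injective (encode_injective this)]
  exact ⟨LinearEquiv.ofInjectiveEndo _ inj, encode (g (0, 0)), fun c => by
    rw [key c]; rfl⟩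

/-- A function on `GF(2)²` whose values sum to zero is affine. -/
theorem affine_of_sum (f : Fin 4 → ZMod 2) (hf : ∑ k, f k = 0) (i : Fin 4) :
    f i = (f 2 - f 0) * ((i.val / 2 : ℕ) : ZMod 2) + (f 1 - f 0) * ((i.val % 2 : ℕ) : ZMod 2)
      + f 0 := by
  rw [Fin.sum_univ_four] at hf
  generalize h0 : f 0 = a at *
  generalize h1 : f 1 = b at *
  generalize h2 : f 2 = c at *
  generalize h3 : f 3 = d at *
  fin_cases i
  · simp [h0]
  · simp [h1]
  · simp [h2]
  · simp [h3]
    clear h0 h1 h2 h3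
    revert a b c d
    decide

theorem sum_perm (σ : Equiv.Perm (Fin 4)) (u : Fin 4 → ZMod 2) (hu : ∑ k, u k = 0) :
    ∑ k, u (σ k) = 0 := by
  rw [Equiv.sum_comp σ u, hu]

theorem sum_quad (ρ : Equiv.Perm (Fin 2 × Fin 2)) (u : Fin 2 × Fin 2 → ZMod 2)
    (hu : ∑ k, u k = 0) : ∑ k, u (ρ (bits k)) = 0 := by
  rw [Equiv.sum_comp bits (fun k => u (ρ k)), Equiv.sum_comp ρ u, hu]

theorem row_affine (σ : Equiv.Perm (Fin 4)) : IsAffinePerm (rowPerm σ) := by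
  apply isAffinePerm_of_eq
  rintro ⟨i, j⟩ k
  have h1 := affine_of_sum _ (sum_perm σ (fun i => ((i.val / 2 : ℕ) : ZMod 2)) (by decide)) i
  have h0 := affine_of_sum _ (sum_perm σ (fun i => ((i.val % 2 : ℕ) : ZMod 2)) (by decide)) i
  fin_cases k
  · simpa [linPart, basisCell, encode, rowPerm] using h1
  · simpa [linPart, basisCell, encode, rowPerm] using h0
  · simp [linPart, basisCell, encode, rowPerm]
  · simp [linPart, basisCell, encode, rowPerm]

theorem col_affine (τ : Equiv.Perm (Fin 4)) : IsAffinePerm (colPerm τ) := by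
  apply isAffinePerm_of_eq
  rintro ⟨i, j⟩ k
  have h1 := affine_of_sum _ (sum_perm τ (fun i => ((i.val / 2 : ℕ) : ZMod 2)) (by decide)) j
  have h0 := affine_of_sum _ (sum_perm τ (fun i => ((i.val % 2 : ℕ) : ZMod 2)) (by decide)) j
  fin_cases k
  · simp [linPart, basisCell, encode, colPerm]
  · simp [linPart, basisCell, encode, colPerm]
  · simpa [linPart, basisCell, encode, colPerm] using h1
  · simpa [linPart, basisCell, encode, colPerm] using h0

theorem bits_symm_div (p : Fin 2 × Fin 2) : (bits.symm p).val / 2 = p.1.val := by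
  revert p; decide

theorem bits_symm_mod (p : Fin 2 × Fin 2) : (bits.symm p).val % 2 = p.2.val := by
  revert p; decide

theorem bits_fst_val (i : Fin 4) : ((bits i).1.val : ℕ) = i.val / 2 := rfl

theorem bits_snd_val (i : Fin 4) : ((bits i).2.val : ℕ) = i.val % 2 := rfl

theorem encode_quad (ρ : Equiv.Perm (Fin 2 × Fin 2)) (i j : Fin 4) :
    encode (quadPerm ρ (i, j)) =
      ![((ρ ((bits i).1, (bits j).1)).1.val : ZMod 2), ((i.val % 2 : ℕ) : ZMod 2),
        ((ρ ((bits i).1, (bits j).1)).2.val : ZMod 2), ((j.val % 2 : ℕ) : ZMod 2)] := by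
  have h : quadPerm ρ (i, j) =
      (bits.symm ((ρ ((bits i).1, (bits j).1)).1, (bits i).2),
       bits.symm ((ρ ((bits i).1, (bits j).1)).2, (bits j).2)) := rfl
  rw [h]
  simp only [encode, bits_symm_div, bits_symm_mod, bits_snd_val]

theorem quad_affine (ρ : Equiv.Perm (Fin 2 × Fin 2)) : IsAffinePerm (quadPerm ρ) := by
  apply isAffinePerm_of_eq
  rintro ⟨i, j⟩ k
  have h1 := affine_of_sum _ (sum_quad ρ (fun p => (p.1.val : ZMod 2)) (by decide))
    (bits.symm ((bits i).1, (bits j).1))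
  have h0 := affine_of_sum _ (sum_quad ρ (fun p => (p.2.val : ZMod 2)) (by decide))
    (bits.symm ((bits i).1, (bits j).1))
  have b0 : bits 0 = (0, 0) := by decide
  have b1 : bits 1 = (0, 1) := by decide
  have b2 : bits 2 = (1, 0) := by decide
  simp only [bits_symm_div, bits_symm_mod, Equiv.apply_symm_apply, b0, b1, b2] at h1 h0
  have e0 : basisCell 0 = (2, 0) := rfl
  have e1 : basisCell 1 = (1, 0) := rfl
  have e2 : basisCell 2 = (0, 2) := rfl
  have e3 : basisCell 3 = (0, 1) := rfl
  simp only [linPart, e0, e1, e2, e3, encode_quad, b0, b1, b2]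
  fin_cases k
  · simpa [encode, bits_fst_val] using h1
  · simp [encode]
  · simpa [encode, bits_fst_val] using h0
  · simp [encode]

/-- Each generator of the group generated by row, column and quadrant permutations is an
affine map of GF(2)⁴; hence the group is contained in AGL(4,2). -/
theorem generators_affine :
    ∀ g ∈ {p : Equiv.Perm (Fin 4 × Fin 4) |
      (∃ σ, p = rowPerm σ) ∨ (∃ τ, p = colPerm τ) ∨ (∃ ρ, p = quadPerm ρ)},
      IsAffinePerm g := by
  rintro g (⟨σ, rfl⟩ | ⟨τ, rfl⟩ | ⟨ρ, rfl⟩)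
  · exact row_affine σ
  · exact col_affine τ
  · exact quad_affine ρ
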